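/- arXiv:math/0012059 — 2 statements merged into one kernel-verified Lean document; each statement's English description precedes it below -/
import Mathlib

section
/- Let Q be an odd positive integer, P ∈ {1,...,Q−1} with gcd(P,Q) = 1, q = exp(iπP/Q), and let n ∈ ℤ. Define c_m = (q^{n−1} + q^{−n+1}) / ((q^{2m+n−1} + q^{−2m−n+1})(q^{2m+n+1} + q^{−2m−n−1})) and s_m = [m]_{q²}[m+n−1]_{q²} / ((q^{2m+n−1} + q^{−2m−n+1})² (q^{2m+n−2} + q^{−2m−n+2})(q^{2m+n} + q^{−2m−n})) for integers m ≥ 0. Then for every integer m ≥ 1: s_m = (q−q⁻¹)⁻⁴ (q+q⁻¹)⁻² (q^{2m+n} + q^{−2m−n})⁻¹ (q^{2m+n−2} + q^{−2m−n+2})⁻¹ ( (q^{2m+n+1} + q^{−2m−n−1})² c_m² + (q^{2m+n−3} + q^{−2m−n+3})² c_{m−1}² − (q² + q⁻²)(q^{2m+n−3} + q^{−2m−n+3})(q^{2m+n+1} + q^{−2m−n−1}) c_m c_{m−1} + (q − q⁻¹)² ). -/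
/-- The q-number `[x]_q = (q^x − q^(−x))/(q − q⁻¹)`. -/
noncomputable def qnum (q : ℂ) (x : ℤ) : ℂ := (q ^ x - q ^ (-x)) / (q - q⁻¹)

theorem qsum_ne (Q : ℕ) (hQ : Odd Q) (q : ℂ) (hq0 : q ≠ 0) (h : q ^ (2 * Q) = 1) (k l : ℤ)
    (hl : l = -k) : q ^ k + q ^ l ≠ 0 := by
  subst hl
  intro h0
  have hk : q ^ k ≠ 0 := zpow_ne_zero _ hq0
  have h1 : (q ^ k) ^ 2 = -1 := by
    rw [zpow_neg] at h0
    field_simp at h0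
    linear_combination h0
  have h2 : ((q ^ k) ^ 2) ^ Q = 1 := by
    rw [← pow_mul, ← zpow_natCast, ← zpow_mul, mul_comm, zpow_mul, zpow_natCast, h, one_zpow]
  rw [h1, hQ.neg_one_pow] at h2
  norm_num at h2

/-- For `q = exp(iπP/Q)` and `n ∈ ℤ`, with
`c_m = (q^{n−1}+q^{−n+1})/((q^{2m+n−1}+q^{−2m−n+1})(q^{2m+n+1}+q^{−2m−n−1}))` and
`s_m = [m]_{q²}[m+n−1]_{q²}/((q^{2m+n−1}+q^{−2m−n+1})²(q^{2m+n−2}+q^{−2m−n+2})(q^{2m+n}+q^{−2m−n}))`,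
one has, for every `m ≥ 1`, the identity expressing `s_m = a_m b_m` through `c_m, c_{m−1}`. -/
theorem stmt_15 (Q P : ℕ) (hQodd : Odd Q) (hQpos : 0 < Q)
    (hP1 : 1 ≤ P) (hPQ : P ≤ Q - 1) (hcop : Nat.Coprime P Q)
    (q : ℂ) (hq : q = Complex.exp (↑Real.pi * Complex.I * (P : ℂ) / (Q : ℂ)))
    (n : ℤ) :
    let c : ℕ → ℂ := fun m =>
      (q ^ (n - 1) + q ^ (-n + 1)) /
        ((q ^ (2 * (m : ℤ) + n - 1) + q ^ (-(2 * (m : ℤ)) - n + 1)) *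
          (q ^ (2 * (m : ℤ) + n + 1) + q ^ (-(2 * (m : ℤ)) - n - 1)))
    let s : ℕ → ℂ := fun m =>
      qnum (q ^ 2) (m : ℤ) * qnum (q ^ 2) ((m : ℤ) + n - 1) /
        ((q ^ (2 * (m : ℤ) + n - 1) + q ^ (-(2 * (m : ℤ)) - n + 1)) ^ 2 *
          ((q ^ (2 * (m : ℤ) + n - 2) + q ^ (-(2 * (m : ℤ)) - n + 2)) *
            (q ^ (2 * (m : ℤ) + n) + q ^ (-(2 * (m : ℤ)) - n))))
    ∀ m : ℕ, 1 ≤ m →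
      s m = ((q - q⁻¹) ^ 4)⁻¹ * ((q + q⁻¹) ^ 2)⁻¹ *
        (q ^ (2 * (m : ℤ) + n) + q ^ (-(2 * (m : ℤ)) - n))⁻¹ *
        (q ^ (2 * (m : ℤ) + n - 2) + q ^ (-(2 * (m : ℤ)) - n + 2))⁻¹ *
        ((q ^ (2 * (m : ℤ) + n + 1) + q ^ (-(2 * (m : ℤ)) - n - 1)) ^ 2 * (c m) ^ 2
          + (q ^ (2 * (m : ℤ) + n - 3) + q ^ (-(2 * (m : ℤ)) - n + 3)) ^ 2 * (c (m - 1)) ^ 2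
          - (q ^ 2 + q⁻¹ ^ 2) * (q ^ (2 * (m : ℤ) + n - 3) + q ^ (-(2 * (m : ℤ)) - n + 3)) *
              (q ^ (2 * (m : ℤ) + n + 1) + q ^ (-(2 * (m : ℤ)) - n - 1)) * c m * c (m - 1)
          + (q - q⁻¹) ^ 2) := by
  intro c s m hm
  have hq0 : q ≠ 0 := by rw [hq]; exact Complex.exp_ne_zero _
  have hQ0 : (Q : ℂ) ≠ 0 := by exact_mod_cast hQpos.ne'
  have h2Q : q ^ (2 * Q) = 1 := by
    rw [hq, ← Complex.exp_nat_mul, Complex.exp_eq_one_iff]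
    refine ⟨P, ?_⟩
    push_cast
    field_simp
  have hne := qsum_ne Q hQodd q hq0 h2Q
  have hA := hne (2 * (m : ℤ) + n - 1) (-(2 * (m : ℤ)) - n + 1) (by ring)
  have hB := hne (2 * (m : ℤ) + n + 1) (-(2 * (m : ℤ)) - n - 1) (by ring)
  have hC := hne (2 * (m : ℤ) + n - 3) (-(2 * (m : ℤ)) - n + 3) (by ring)
  have hD := hne (2 * (m : ℤ) + n) (-(2 * (m : ℤ)) - n) (by ring)
  have hE := hne (2 * (m : ℤ) + n - 2) (-(2 * (m : ℤ)) - n + 2) (by ring)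
  have hqp : q + q⁻¹ ≠ 0 := by
    have := hne 1 (-1) (by ring)
    simpa using this
  have hcm : (q ^ (2 * (m : ℤ) + n + 1) + q ^ (-(2 * (m : ℤ)) - n - 1)) * c m =
      (q ^ (n - 1) + q ^ (-n + 1)) /
        (q ^ (2 * (m : ℤ) + n - 1) + q ^ (-(2 * (m : ℤ)) - n + 1)) := by
    simp only [c]
    field_simp
  have hcm1 : (q ^ (2 * (m : ℤ) + n - 3) + q ^ (-(2 * (m : ℤ)) - n + 3)) * c (m - 1) =
      (q ^ (n - 1) + q ^ (-n + 1)) /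
        (q ^ (2 * (m : ℤ) + n - 1) + q ^ (-(2 * (m : ℤ)) - n + 1)) := by
    simp only [c]
    rw [Nat.cast_sub hm, Nat.cast_one,
      show 2 * ((m : ℤ) - 1) + n - 1 = 2 * (m : ℤ) + n - 3 by ring,
      show -(2 * ((m : ℤ) - 1)) - n + 1 = -(2 * (m : ℤ)) - n + 3 by ring,
      show 2 * ((m : ℤ) - 1) + n + 1 = 2 * (m : ℤ) + n - 1 by ring,
      show -(2 * ((m : ℤ) - 1)) - n - 1 = -(2 * (m : ℤ)) - n + 1 by ring]
    field_simp
  have hkey : ((q ^ 2) ^ (m : ℤ) - (q ^ 2) ^ (-(m : ℤ))) *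
      ((q ^ 2) ^ ((m : ℤ) + n - 1) - (q ^ 2) ^ (-((m : ℤ) + n - 1))) =
      (q ^ (2 * (m : ℤ) + n - 1) + q ^ (-(2 * (m : ℤ)) - n + 1)) ^ 2
        - (q ^ (n - 1) + q ^ (-n + 1)) ^ 2 := by
    have e : ∀ k : ℤ, (q ^ 2) ^ k = q ^ k * q ^ k := fun k => by rw [pow_two, mul_zpow]
    rw [show 2 * (m : ℤ) + n - 1 = m + m + (n - 1) by ring,
      show -(2 * (m : ℤ)) - n + 1 = -(m + m + (n - 1)) by ring,
      show -n + 1 = -(n - 1) by ring, show (m : ℤ) + n - 1 = m + (n - 1) by ring]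
    simp only [e, zpow_neg, zpow_add₀ hq0 (m : ℤ), zpow_add₀ hq0 (m + m : ℤ)]
    have hx : q ^ (m : ℤ) ≠ 0 := zpow_ne_zero _ hq0
    have hy : q ^ (n - 1) ≠ 0 := zpow_ne_zero _ hq0
    generalize q ^ (m : ℤ) = x at *
    generalize q ^ (n - 1) = y at *
    field_simp
    ring
  have hqq : q ^ 2 - (q ^ 2)⁻¹ = (q - q⁻¹) * (q + q⁻¹) := by field_simp; ring
  have hqi : q * q⁻¹ = 1 := mul_inv_cancel₀ hq0
  simp only [s, qnum]
  rw [hqq, div_mul_div_comm, hkey]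
  generalize hF : c m = F at *
  generalize hG : c (m - 1) = G at *
  clear_value c s
  generalize q ^ (2 * (m : ℤ) + n - 1) + q ^ (-(2 * (m : ℤ)) - n + 1) = A at *
  generalize q ^ (2 * (m : ℤ) + n + 1) + q ^ (-(2 * (m : ℤ)) - n - 1) = B at *
  generalize q ^ (2 * (m : ℤ) + n - 3) + q ^ (-(2 * (m : ℤ)) - n + 3) = C at *
  generalize q ^ (2 * (m : ℤ) + n) + q ^ (-(2 * (m : ℤ)) - n) = D at *
  generalize q ^ (2 * (m : ℤ) + n - 2) + q ^ (-(2 * (m : ℤ)) - n + 2) = E at *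
  generalize q ^ (n - 1) + q ^ (-n + 1) = N at *
  have hbr : B ^ 2 * F ^ 2 + C ^ 2 * G ^ 2 - (q ^ 2 + q⁻¹ ^ 2) * C * B * F * G + (q - q⁻¹) ^ 2
      = (q - q⁻¹) ^ 2 * ((A ^ 2 - N ^ 2) / A ^ 2) := by
    have h1 : (A ^ 2 - N ^ 2) / A ^ 2 = 1 - (N / A) ^ 2 := by field_simp
    rw [h1]
    have : B ^ 2 * F ^ 2 + C ^ 2 * G ^ 2 - (q ^ 2 + q⁻¹ ^ 2) * C * B * F * G
      = (B * F) ^ 2 + (C * G) ^ 2 - (q ^ 2 + q⁻¹ ^ 2) * (C * G) * (B * F) := by ring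
    rw [this, hcm, hcm1]
    linear_combination (-2 * (N / A) ^ 2) * hqi
  rw [hbr]
  generalize q + q⁻¹ = t at *
  by_cases hz : q - q⁻¹ = 0
  · simp [hz]
  generalize q - q⁻¹ = z at *
  field_simp
end

section
/- Let Q be an odd positive integer, P ∈ {1,...,Q−1} with gcd(P,Q) = 1, q = exp(iπP/Q), fix n ∈ {1,...,Q} and set d = Q+1−n. Set c_m = (q^{n−1}+q^{−n+1})/((q^{2m+n−1}+q^{−2m−n+1})(q^{2m+n+1}+q^{−2m−n−1})) and d_m = (q^{n−1}+q^{−n+1})[2m+n]_q/((q^{2m+n−1}+q^{−2m−n+1})(q^{2m+n+1}+q^{−2m−n−1})) for m = 0,...,d−1, and let a_1,...,a_{d−1} be any complex numbers satisfying a_m² = [m]_{q²}[m+n−1]_{q²}/((q^{2m+n−1}+q^{−2m−n+1})²(q^{2m+n−2}+q^{−2m−n+2})(q^{2m+n}+q^{−2m−n})), with b_m = a_m. Define d×d matrices (indices 0,...,d−1): ρ(Z) with entries ρ(Z)_{m−1,m} = −(q²−q⁻²)q^{2m+n−1}a_m, ρ(Z)_{m+1,m} = (q²−q⁻²)q^{−2m−n−1}b_{m+1},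 ρ(Z)_{mm} = (q+q⁻¹)c_m; ρ(X) with ρ(X)_{m−1,m} = (q+q⁻¹)a_m, ρ(X)_{m+1,m} = (q+q⁻¹)b_{m+1}, ρ(X)_{mm} = d_m; ρ(Y) with ρ(Y)_{m−1,m} = (q+q⁻¹)q^{2(2m+n−1)}a_m, ρ(Y)_{m+1,m} = (q+q⁻¹)q^{−2(2m+n+1)}b_{m+1}, ρ(Y)_{mm} = −d_m; all other entries zero. Then ρ(Z)ρ(X) = q⁻²ρ(X)ρ(Z), ρ(Z)ρ(Y) = q²ρ(Y)ρ(Z), and q⁻¹ρ(X)ρ(Y) − qρ(Y)ρ(X) = −(1 − ρ(Z)²)/(q − q⁻¹). -/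
set_option linter.unusedSectionVars false
set_option linter.unusedSimpArgs false


/-- tridiagonal entries -/
def triE (u l D : ℕ → ℂ) (i j : ℕ) : ℂ :=
  if j = i + 1 then u j else if i = j + 1 then l i else if i = j then D i else 0

lemma triE_sum (u l D F : ℕ → ℂ) (d i : ℕ) (hi : i < d) (hu : u d = 0) (hl : l 0 = 0) :
    ∑ k ∈ Finset.range d, triE u l D i k * F k
      = u (i+1) * F (i+1) + l i * F (i-1) + D i * F i := by
  have h : ∀ k ∈ Finset.range d, triE u l D i k * F k =
      (if k = i + 1 then u (i+1) * F (i+1) else 0) + (if k = i - 1 then l i * F (i-1) else 0)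
        + (if k = i then D i * F i else 0) := by
    intro k _
    unfold triE
    rcases Nat.eq_zero_or_pos i with h0 | h0
    · subst h0
      by_cases hk : k = 0
      · subst hk; simp [hl]
      · by_cases hk1 : k = 1
        · subst hk1; simp
        · simp [hk, hk1, Ne.symm hk]
    · split_ifs <;> first | omega | (subst_vars; simp)
  rw [Finset.sum_congr rfl h, Finset.sum_add_distrib, Finset.sum_add_distrib,
    Finset.sum_ite_eq', Finset.sum_ite_eq', Finset.sum_ite_eq']
  have h1 : i - 1 ∈ Finset.range d := by simp; omega
  have h2 : i ∈ Finset.range d := by simpa using hi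
  rw [if_pos h1, if_pos h2]
  congr 2
  split_ifs with h3
  · rfl
  · have : i + 1 = d := by simp at h3; omega
    rw [this, hu]; simp

lemma tri_mul (u l D u' l' D' : ℕ → ℂ) (d : ℕ) (hu : u d = 0) (hl : l 0 = 0) (i j : Fin d) :
    ((Matrix.of fun i j : Fin d => triE u l D i j) * (Matrix.of fun i j : Fin d => triE u' l' D' i j)) i j
     = u (i+1) * triE u' l' D' (i+1) j + l i * triE u' l' D' (i-1) j + D i * triE u' l' D' i j := by
  rw [Matrix.mul_apply, ← triE_sum u l D (fun k => triE u' l' D' k j) d i i.2 hu hl,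
    ← Fin.sum_univ_eq_sum_range (fun k => triE u l D i k * triE u' l' D' k j)]
  rfl

/-- entries of a product of tridiagonal matrices -/
def penE (u l D u' l' D' : ℕ → ℂ) (i j : ℕ) : ℂ :=
  if j = i + 2 then u (i+1) * u' (i+2) else
  if j = i + 1 then u (i+1) * D' (i+1) + D i * u' (i+1) else
  if j = i then u (i+1) * l' (i+1) + l i * u' i + D i * D' i else
  if i = j + 1 then l (j+1) * D' j + D (j+1) * l' (j+1) else
  if i = j + 2 then l (j+2) * l' (j+1) else 0

lemma tri_mul' (u l D u' l' D' : ℕ → ℂ) (d : ℕ) (hu : u d = 0) (hl : l 0 = 0) (i j : Fin d) :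
    ((Matrix.of fun i j : Fin d => triE u l D i j) * (Matrix.of fun i j : Fin d => triE u' l' D' i j)) i j
     = penE u l D u' l' D' i j := by
  rw [tri_mul u l D u' l' D' d hu hl]
  obtain ⟨i, hi⟩ := i
  obtain ⟨j, hj⟩ := j
  dsimp only
  unfold penE triE
  rcases i with _ | i
  · rw [hl]
    rcases j with _ | _ | _ | j <;> simp
  · simp only [Nat.add_sub_cancel]
    split_ifs <;> first | omega | (subst_vars; simp)

/-- value of `α²` -/
noncomputable def ff (q κ y : ℂ) : ℂ :=
  ((y^2+q^2)^2 - κ^2 * (q^2 * y^2)) * q^6 * y^2 /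
    ((q^4-1)^2 * (y^2+q^2)^2 * ((y^2+q^4) * (y^2+1)))


section scal
variable (q κ y A B : ℂ)


lemma sc_ZX_up (hq : q ≠ 0) (hq2 : q^2 - 1 ≠ 0) (hq2' : q^2 + 1 ≠ 0) (hx0 : y ≠ 0)
  (hx1 : y ^ 2 + 1 ≠ 0) (hx2 : y ^ 2 + q^2 ≠ 0) (hx3 : q^2 * y ^ 2 + 1 ≠ 0)
  (hx4 : y ^ 2 + q^4 ≠ 0) (hx5 : q^4 * y ^ 2 + 1 ≠ 0) (hx6 : q^6 * y ^ 2 + 1 ≠ 0)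
  : ((-(q^2 - (q^2)⁻¹) * ((q^2*y)/q) * B) * ((κ * q^2 * (q^2*y)^2 / (((q^2*y)^2+q^2) * (q^2*(q^2*y)^2+1))) * ((q^2*y) - (q^2*y)⁻¹) / (q - q⁻¹)) + ((q + q⁻¹) * (κ * q^2 * y^2 / ((y^2+q^2) * (q^2*y^2+1)))) * ((q + q⁻¹) * B)) = (q⁻¹^2) * (((q + q⁻¹) * B) * ((q + q⁻¹) * (κ * q^2 * (q^2*y)^2 / (((q^2*y)^2+q^2) * (q^2*(q^2*y)^2+1)))) + ((κ * q^2 * y^2 / ((y^2+q^2) * (q^2*y^2+1))) * (y - y⁻¹) / (q - q⁻¹)) * (-(q^2 - (q^2)⁻¹) * ((q^2*y)/q) * B)) := by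
  have e1 : q - q⁻¹ = (q^2-1)/q := by field_simp
  have e3 : (q^2 * y)^2 + q^2 = q^2 * (q^2*y^2+1) := by ring
  have e4 : q^2 * (q^2*y)^2 + 1 = q^6*y^2+1 := by ring
  rw [e1, e3, e4]
  field_simp
  ring

lemma sc_ZX_lo (hq : q ≠ 0) (hq2 : q^2 - 1 ≠ 0) (hq2' : q^2 + 1 ≠ 0) (hx0 : y ≠ 0)
  (hx1 : y ^ 2 + 1 ≠ 0) (hx2 : y ^ 2 + q^2 ≠ 0) (hx3 : q^2 * y ^ 2 + 1 ≠ 0)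
  (hx4 : y ^ 2 + q^4 ≠ 0) (hx5 : q^4 * y ^ 2 + 1 ≠ 0) (hx6 : q^6 * y ^ 2 + 1 ≠ 0)
  : (((q^2 - (q^2)⁻¹) * (q/(q^2*y)) * B) * ((κ * q^2 * y^2 / ((y^2+q^2) * (q^2*y^2+1))) * (y - y⁻¹) / (q - q⁻¹)) + ((q + q⁻¹) * (κ * q^2 * (q^2*y)^2 / (((q^2*y)^2+q^2) * (q^2*(q^2*y)^2+1)))) * ((q + q⁻¹) * B)) = (q⁻¹^2) * (((q + q⁻¹) * B) * ((q + q⁻¹) * (κ * q^2 * y^2 / ((y^2+q^2) * (q^2*y^2+1)))) + ((κ * q^2 * (q^2*y)^2 / (((q^2*y)^2+q^2) * (q^2*(q^2*y)^2+1))) * ((q^2*y) - (q^2*y)⁻¹) / (q - q⁻¹)) * ((q^2 - (q^2)⁻¹) * (q/(q^2*y)) * B)) := by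
  have e1 : q - q⁻¹ = (q^2-1)/q := by field_simp
  have e3 : (q^2 * y)^2 + q^2 = q^2 * (q^2*y^2+1) := by ring
  have e4 : q^2 * (q^2*y)^2 + 1 = q^6*y^2+1 := by ring
  rw [e1, e3, e4]
  field_simp
  ring

lemma sc_ZX_di (hq : q ≠ 0) (hq2 : q^2 - 1 ≠ 0) (hq2' : q^2 + 1 ≠ 0) (hx0 : y ≠ 0)
  (hx1 : y ^ 2 + 1 ≠ 0) (hx2 : y ^ 2 + q^2 ≠ 0) (hx3 : q^2 * y ^ 2 + 1 ≠ 0)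
  (hx4 : y ^ 2 + q^4 ≠ 0) (hx5 : q^4 * y ^ 2 + 1 ≠ 0) (hx6 : q^6 * y ^ 2 + 1 ≠ 0)
  (hA : A^2 = ff q κ y) (hB : B^2 = ff q κ (q^2*y)) : ((-(q^2 - (q^2)⁻¹) * ((q^2*y)/q) * B) * ((q + q⁻¹) * B) + ((q^2 - (q^2)⁻¹) * (q/y) * A) * ((q + q⁻¹) * A) + ((q + q⁻¹) * (κ * q^2 * y^2 / ((y^2+q^2) * (q^2*y^2+1)))) * ((κ * q^2 * y^2 / ((y^2+q^2) * (q^2*y^2+1))) * (y - y⁻¹) / (q - q⁻¹))) = (q⁻¹^2) * (((q + q⁻¹) * B) * ((q^2 - (q^2)⁻¹) * (q/(q^2*y)) * B) + ((q + q⁻¹) * A) * (-(q^2 - (q^2)⁻¹) * (y/q) * A) + ((κ * q^2 * y^2 / ((y^2+q^2) * (q^2*y^2+1))) * (y - y⁻¹) / (q - q⁻¹)) * ((q + q⁻¹) * (κ * q^2 * y^2 / ((y^2+q^2) * (q^2*y^2+1))))) := by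
  have e1 : q - q⁻¹ = (q^2-1)/q := by field_simp
  have e3 : (q^2 * y)^2 + q^2 = q^2 * (q^2*y^2+1) := by ring
  have e4 : q^2 * (q^2*y)^2 + 1 = q^6*y^2+1 := by ring
  have e5 : (q^2*y)^2 + q^4 = q^4 * (y^2+1) := by ring
  have e6 : (q^2*y)^2 + 1 = q^4*y^2+1 := by ring
  have e7 : q^4 - 1 = (q^2-1)*(q^2+1) := by ring
  have key : (((-(q^2 - (q^2)⁻¹) * ((q^2*y)/q) * 1)*((q + q⁻¹) * 1))*B^2 + (((q^2 - (q^2)⁻¹) * (q/y) * 1)*((q + q⁻¹) * 1)) * A^2 + ((q + q⁻¹) * (κ * q^2 * y^2 / ((y^2+q^2) * (q^2*y^2+1)))) * ((κ * q^2 * y^2 / ((y^2+q^2) * (q^2*y^2+1))) * (y - y⁻¹) / (q - q⁻¹))) = (q⁻¹^2) * ((((q + q⁻¹) * 1)*((q^2 - (q^2)⁻¹) * (q/(q^2*y)) * 1))*B^2 + (((q + q⁻¹) * 1)*(-(q^2 - (q^2)⁻¹) * (y/q) * 1)) * A^2 + ((κ * q^2 * y^2 / ((y^2+q^2) * (q^2*y^2+1)))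 * (y - y⁻¹) / (q - q⁻¹)) * ((q + q⁻¹) * (κ * q^2 * y^2 / ((y^2+q^2) * (q^2*y^2+1))))) := by
    rw [hA, hB]
    unfold ff
    rw [e1, e3, e5, e6, e7]
    field_simp
    ring
  linear_combination key

lemma sc_ZY_up (hq : q ≠ 0) (hq2 : q^2 - 1 ≠ 0) (hq2' : q^2 + 1 ≠ 0) (hx0 : y ≠ 0)
  (hx1 : y ^ 2 + 1 ≠ 0) (hx2 : y ^ 2 + q^2 ≠ 0) (hx3 : q^2 * y ^ 2 + 1 ≠ 0)
  (hx4 : y ^ 2 + q^4 ≠ 0) (hx5 : q^4 * y ^ 2 + 1 ≠ 0) (hx6 : q^6 * y ^ 2 + 1 ≠ 0)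
  : ((-(q^2 - (q^2)⁻¹) * ((q^2*y)/q) * B) * (-((κ * q^2 * (q^2*y)^2 / (((q^2*y)^2+q^2) * (q^2*(q^2*y)^2+1))) * ((q^2*y) - (q^2*y)⁻¹) / (q - q⁻¹))) + ((q + q⁻¹) * (κ * q^2 * y^2 / ((y^2+q^2) * (q^2*y^2+1)))) * ((q + q⁻¹) * ((q^2*y)/q)^2 * B)) = (q^2) * (((q + q⁻¹) * ((q^2*y)/q)^2 * B) * ((q + q⁻¹) * (κ * q^2 * (q^2*y)^2 / (((q^2*y)^2+q^2) * (q^2*(q^2*y)^2+1)))) + (-((κ * q^2 * y^2 / ((y^2+q^2) * (q^2*y^2+1))) * (y - y⁻¹) / (q - q⁻¹))) * (-(q^2 - (q^2)⁻¹) * ((q^2*y)/q) * B)) := by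
  have e1 : q - q⁻¹ = (q^2-1)/q := by field_simp
  have e3 : (q^2 * y)^2 + q^2 = q^2 * (q^2*y^2+1) := by ring
  have e4 : q^2 * (q^2*y)^2 + 1 = q^6*y^2+1 := by ring
  rw [e1, e3, e4]
  field_simp
  ring

lemma sc_ZY_lo (hq : q ≠ 0) (hq2 : q^2 - 1 ≠ 0) (hq2' : q^2 + 1 ≠ 0) (hx0 : y ≠ 0)
  (hx1 : y ^ 2 + 1 ≠ 0) (hx2 : y ^ 2 + q^2 ≠ 0) (hx3 : q^2 * y ^ 2 + 1 ≠ 0)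
  (hx4 : y ^ 2 + q^4 ≠ 0) (hx5 : q^4 * y ^ 2 + 1 ≠ 0) (hx6 : q^6 * y ^ 2 + 1 ≠ 0)
  : (((q^2 - (q^2)⁻¹) * (q/(q^2*y)) * B) * (-((κ * q^2 * y^2 / ((y^2+q^2) * (q^2*y^2+1))) * (y - y⁻¹) / (q - q⁻¹))) + ((q + q⁻¹) * (κ * q^2 * (q^2*y)^2 / (((q^2*y)^2+q^2) * (q^2*(q^2*y)^2+1)))) * ((q + q⁻¹) * (q/(q^2*y))^2 * B)) = (q^2) * (((q + q⁻¹) * (q/(q^2*y))^2 * B) * ((q + q⁻¹) * (κ * q^2 * y^2 / ((y^2+q^2) * (q^2*y^2+1)))) + (-((κ * q^2 * (q^2*y)^2 / (((q^2*y)^2+q^2) * (q^2*(q^2*y)^2+1))) * ((q^2*y) - (q^2*y)⁻¹) / (q - q⁻¹))) * ((q^2 - (q^2)⁻¹) * (q/(q^2*y)) * B)) := by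
  have e1 : q - q⁻¹ = (q^2-1)/q := by field_simp
  have e3 : (q^2 * y)^2 + q^2 = q^2 * (q^2*y^2+1) := by ring
  have e4 : q^2 * (q^2*y)^2 + 1 = q^6*y^2+1 := by ring
  rw [e1, e3, e4]
  field_simp
  ring

lemma sc_ZY_di (hq : q ≠ 0) (hq2 : q^2 - 1 ≠ 0) (hq2' : q^2 + 1 ≠ 0) (hx0 : y ≠ 0)
  (hx1 : y ^ 2 + 1 ≠ 0) (hx2 : y ^ 2 + q^2 ≠ 0) (hx3 : q^2 * y ^ 2 + 1 ≠ 0)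
  (hx4 : y ^ 2 + q^4 ≠ 0) (hx5 : q^4 * y ^ 2 + 1 ≠ 0) (hx6 : q^6 * y ^ 2 + 1 ≠ 0)
  (hA : A^2 = ff q κ y) (hB : B^2 = ff q κ (q^2*y)) : ((-(q^2 - (q^2)⁻¹) * ((q^2*y)/q) * B) * ((q + q⁻¹) * (q/(q^2*y))^2 * B) + ((q^2 - (q^2)⁻¹) * (q/y) * A) * ((q + q⁻¹) * (y/q)^2 * A) + ((q + q⁻¹) * (κ * q^2 * y^2 / ((y^2+q^2) * (q^2*y^2+1)))) * (-((κ * q^2 * y^2 / ((y^2+q^2) * (q^2*y^2+1))) * (y - y⁻¹) / (q - q⁻¹)))) = (q^2) * (((q + q⁻¹) * ((q^2*y)/q)^2 * B) * ((q^2 - (q^2)⁻¹) * (q/(q^2*y)) * B) + ((q + q⁻¹) * (q/y)^2 * A) * (-(q^2 - (q^2)⁻¹) * (y/q) * A) + (-((κ * q^2 * y^2 / ((y^2+q^2) * (q^2*y^2+1))) * (y - y⁻¹) / (q - q⁻¹))) * ((q + q⁻¹) * (κ * q^2 * y^2 / ((y^2+q^2) * (q^2*y^2+1))))) := by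
  have e1 : q - q⁻¹ = (q^2-1)/q := by field_simp
  have e3 : (q^2 * y)^2 + q^2 = q^2 * (q^2*y^2+1) := by ring
  have e4 : q^2 * (q^2*y)^2 + 1 = q^6*y^2+1 := by ring
  have e5 : (q^2*y)^2 + q^4 = q^4 * (y^2+1) := by ring
  have e6 : (q^2*y)^2 + 1 = q^4*y^2+1 := by ring
  have e7 : q^4 - 1 = (q^2-1)*(q^2+1) := by ring
  have key : (((-(q^2 - (q^2)⁻¹) * ((q^2*y)/q) * 1)*((q + q⁻¹) * (q/(q^2*y))^2 * 1))*B^2 + (((q^2 - (q^2)⁻¹) * (q/y) * 1)*((q + q⁻¹) * (y/q)^2 * 1)) * A^2 + ((q + q⁻¹) * (κ * q^2 * y^2 / ((y^2+q^2) * (q^2*y^2+1)))) * (-((κ * q^2 * y^2 / ((y^2+q^2) * (q^2*y^2+1))) * (y - y⁻¹) / (q - q⁻¹)))) = (q^2) * ((((q + q⁻¹) * ((q^2*y)/q)^2 * 1)*((q^2 - (q^2)⁻¹) * (q/(q^2*y)) * 1))*B^2 + (((q + q⁻¹) * (q/y)^2 * 1)*(-(q^2 - (q^2)⁻¹) * (y/q)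 * 1)) * A^2 + (-((κ * q^2 * y^2 / ((y^2+q^2) * (q^2*y^2+1))) * (y - y⁻¹) / (q - q⁻¹))) * ((q + q⁻¹) * (κ * q^2 * y^2 / ((y^2+q^2) * (q^2*y^2+1))))) := by
    rw [hA, hB]
    unfold ff
    rw [e1, e3, e5, e6, e7]
    field_simp
    ring
  linear_combination key

lemma sc_XY_up (hq : q ≠ 0) (hq2 : q^2 - 1 ≠ 0) (hq2' : q^2 + 1 ≠ 0) (hx0 : y ≠ 0)
  (hx1 : y ^ 2 + 1 ≠ 0) (hx2 : y ^ 2 + q^2 ≠ 0) (hx3 : q^2 * y ^ 2 + 1 ≠ 0)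
  (hx4 : y ^ 2 + q^4 ≠ 0) (hx5 : q^4 * y ^ 2 + 1 ≠ 0) (hx6 : q^6 * y ^ 2 + 1 ≠ 0)
  : q⁻¹ * (((q + q⁻¹) * B) * (-((κ * q^2 * (q^2*y)^2 / (((q^2*y)^2+q^2) * (q^2*(q^2*y)^2+1))) * ((q^2*y) - (q^2*y)⁻¹) / (q - q⁻¹))) + ((κ * q^2 * y^2 / ((y^2+q^2) * (q^2*y^2+1))) * (y - y⁻¹) / (q - q⁻¹)) * ((q + q⁻¹) * ((q^2*y)/q)^2 * B)) - q * (((q + q⁻¹) * ((q^2*y)/q)^2 * B) * ((κ * q^2 * (q^2*y)^2 / (((q^2*y)^2+q^2) * (q^2*(q^2*y)^2+1))) * ((q^2*y) - (q^2*y)⁻¹) / (q - q⁻¹)) + (-((κ * q^2 * y^2 / ((y^2+q^2) * (q^2*y^2+1))) * (y - y⁻¹) / (q - q⁻¹))) * ((q + q⁻¹) * B)) = -((q - q⁻¹)⁻¹ * (0 - ((-(q^2 - (q^2)⁻¹) * ((q^2*y)/q) * B) * ((q + q⁻¹) * (κ * q^2 * (q^2*y)^2 / (((q^2*y)^2+q^2)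 * (q^2*(q^2*y)^2+1)))) + ((q + q⁻¹) * (κ * q^2 * y^2 / ((y^2+q^2) * (q^2*y^2+1)))) * (-(q^2 - (q^2)⁻¹) * ((q^2*y)/q) * B)))) := by
  have e1 : q - q⁻¹ = (q^2-1)/q := by field_simp
  have e3 : (q^2 * y)^2 + q^2 = q^2 * (q^2*y^2+1) := by ring
  have e4 : q^2 * (q^2*y)^2 + 1 = q^6*y^2+1 := by ring
  rw [e1, e3, e4]
  field_simp
  ring

lemma sc_XY_lo (hq : q ≠ 0) (hq2 : q^2 - 1 ≠ 0) (hq2' : q^2 + 1 ≠ 0) (hx0 : y ≠ 0)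
  (hx1 : y ^ 2 + 1 ≠ 0) (hx2 : y ^ 2 + q^2 ≠ 0) (hx3 : q^2 * y ^ 2 + 1 ≠ 0)
  (hx4 : y ^ 2 + q^4 ≠ 0) (hx5 : q^4 * y ^ 2 + 1 ≠ 0) (hx6 : q^6 * y ^ 2 + 1 ≠ 0)
  : q⁻¹ * (((q + q⁻¹) * B) * (-((κ * q^2 * y^2 / ((y^2+q^2) * (q^2*y^2+1))) * (y - y⁻¹) / (q - q⁻¹))) + ((κ * q^2 * (q^2*y)^2 / (((q^2*y)^2+q^2) * (q^2*(q^2*y)^2+1))) * ((q^2*y) - (q^2*y)⁻¹) / (q - q⁻¹)) * ((q + q⁻¹) * (q/(q^2*y))^2 * B)) - q * (((q + q⁻¹) * (q/(q^2*y))^2 * B) * ((κ * q^2 * y^2 / ((y^2+q^2) * (q^2*y^2+1))) * (y - y⁻¹) / (q - q⁻¹)) + (-((κ * q^2 * (q^2*y)^2 / (((q^2*y)^2+q^2) * (q^2*(q^2*y)^2+1))) * ((q^2*y) - (q^2*y)⁻¹) / (q - q⁻¹))) * ((q + q⁻¹) * B)) = -((q - q⁻¹)⁻¹ * (0 - (((q^2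 - (q^2)⁻¹) * (q/(q^2*y)) * B) * ((q + q⁻¹) * (κ * q^2 * y^2 / ((y^2+q^2) * (q^2*y^2+1)))) + ((q + q⁻¹) * (κ * q^2 * (q^2*y)^2 / (((q^2*y)^2+q^2) * (q^2*(q^2*y)^2+1)))) * ((q^2 - (q^2)⁻¹) * (q/(q^2*y)) * B)))) := by
  have e1 : q - q⁻¹ = (q^2-1)/q := by field_simp
  have e3 : (q^2 * y)^2 + q^2 = q^2 * (q^2*y^2+1) := by ring
  have e4 : q^2 * (q^2*y)^2 + 1 = q^6*y^2+1 := by ring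
  rw [e1, e3, e4]
  field_simp
  ring

lemma sc_XY_di (hq : q ≠ 0) (hq2 : q^2 - 1 ≠ 0) (hq2' : q^2 + 1 ≠ 0) (hx0 : y ≠ 0)
  (hx1 : y ^ 2 + 1 ≠ 0) (hx2 : y ^ 2 + q^2 ≠ 0) (hx3 : q^2 * y ^ 2 + 1 ≠ 0)
  (hx4 : y ^ 2 + q^4 ≠ 0) (hx5 : q^4 * y ^ 2 + 1 ≠ 0) (hx6 : q^6 * y ^ 2 + 1 ≠ 0)
  (hA : A^2 = ff q κ y) (hB : B^2 = ff q κ (q^2*y)) : q⁻¹ * (((q + q⁻¹) * B) * ((q + q⁻¹) * (q/(q^2*y))^2 * B) + ((q + q⁻¹) * A) * ((q + q⁻¹) * (y/q)^2 * A) + ((κ * q^2 * y^2 / ((y^2+q^2) * (q^2*y^2+1))) * (y - y⁻¹) / (q - q⁻¹)) * (-((κ * q^2 * y^2 / ((y^2+q^2) * (q^2*y^2+1))) * (y - y⁻¹) / (q - q⁻¹)))) - q * (((q + q⁻¹) * ((q^2*y)/q)^2 * B) * ((q + q⁻¹) * B) + ((q + q⁻¹) * (q/y)^2 * A) * ((q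 + q⁻¹) * A) + (-((κ * q^2 * y^2 / ((y^2+q^2) * (q^2*y^2+1))) * (y - y⁻¹) / (q - q⁻¹))) * ((κ * q^2 * y^2 / ((y^2+q^2) * (q^2*y^2+1))) * (y - y⁻¹) / (q - q⁻¹))) = -((q - q⁻¹)⁻¹ * (1 - ((-(q^2 - (q^2)⁻¹) * ((q^2*y)/q) * B) * ((q^2 - (q^2)⁻¹) * (q/(q^2*y)) * B) + ((q^2 - (q^2)⁻¹) * (q/y) * A) * (-(q^2 - (q^2)⁻¹) * (y/q) * A) + ((q + q⁻¹) * (κ * q^2 * y^2 / ((y^2+q^2) * (q^2*y^2+1)))) * ((q + q⁻¹) * (κ * q^2 * y^2 / ((y^2+q^2) * (q^2*y^2+1))))))) := by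
  have e1 : q - q⁻¹ = (q^2-1)/q := by field_simp
  have e3 : (q^2 * y)^2 + q^2 = q^2 * (q^2*y^2+1) := by ring
  have e4 : q^2 * (q^2*y)^2 + 1 = q^6*y^2+1 := by ring
  have e5 : (q^2*y)^2 + q^4 = q^4 * (y^2+1) := by ring
  have e6 : (q^2*y)^2 + 1 = q^4*y^2+1 := by ring
  have e7 : q^4 - 1 = (q^2-1)*(q^2+1) := by ring
  have key : q⁻¹ * ((((q + q⁻¹) * 1)*((q + q⁻¹) * (q/(q^2*y))^2 * 1))*B^2 + (((q + q⁻¹) * 1)*((q + q⁻¹) * (y/q)^2 * 1)) * A^2 + ((κ * q^2 * y^2 / ((y^2+q^2) * (q^2*y^2+1))) * (y - y⁻¹) / (q - q⁻¹)) * (-((κ * q^2 * y^2 / ((y^2+q^2) * (q^2*y^2+1))) * (y - y⁻¹) / (q - q⁻¹)))) - q * ((((q + q⁻¹) * ((q^2*y)/q)^2 * 1)*((q + q⁻¹) * 1))*B^2 + (((q + q⁻¹) * (q/y)^2 * 1)*((q + q⁻¹) * 1)) * A^2 + (-((κ * q^2 * y^2 / ((y^2+q^2) * (q^2*y^2+1)))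 * (y - y⁻¹) / (q - q⁻¹))) * ((κ * q^2 * y^2 / ((y^2+q^2) * (q^2*y^2+1))) * (y - y⁻¹) / (q - q⁻¹))) = -((q - q⁻¹)⁻¹ * (1 - (((-(q^2 - (q^2)⁻¹) * ((q^2*y)/q) * 1)*((q^2 - (q^2)⁻¹) * (q/(q^2*y)) * 1))*B^2 + (((q^2 - (q^2)⁻¹) * (q/y) * 1)*(-(q^2 - (q^2)⁻¹) * (y/q) * 1)) * A^2 + ((q + q⁻¹) * (κ * q^2 * y^2 / ((y^2+q^2) * (q^2*y^2+1)))) * ((q + q⁻¹) * (κ * q^2 * y^2 / ((y^2+q^2) * (q^2*y^2+1))))))) := by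
    rw [hA, hB]
    unfold ff
    rw [e1, e3, e5, e6, e7]
    field_simp
    ring
  linear_combination key

end scal

section core
variable (q κ : ℂ) (d : ℕ) (x α : ℕ → ℂ)

noncomputable def uZ (m : ℕ) : ℂ := -(q^2 - (q^2)⁻¹) * (x m / q) * α m
noncomputable def lZ (m : ℕ) : ℂ := (q^2 - (q^2)⁻¹) * (q / x m) * α m
noncomputable def uX (m : ℕ) : ℂ := (q + q⁻¹) * α m
noncomputable def uY (m : ℕ) : ℂ := (q + q⁻¹) * (x m / q)^2 * α m
noncomputable def lY (m : ℕ) : ℂ := (q + q⁻¹) * (q / x m)^2 * α m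
noncomputable def cc (m : ℕ) : ℂ := κ * q^2 * x m ^ 2 / ((x m ^ 2 + q^2) * (q^2 * x m ^2 + 1))
noncomputable def DZ (m : ℕ) : ℂ := (q + q⁻¹) * cc q κ x m
noncomputable def DX (m : ℕ) : ℂ := cc q κ x m * (x m - (x m)⁻¹) / (q - q⁻¹)
noncomputable def DY (m : ℕ) : ℂ := - DX q κ x m

noncomputable def mZ : Matrix (Fin d) (Fin d) ℂ :=
  Matrix.of fun i j => triE (uZ q x α) (lZ q x α) (DZ q κ x) i j
noncomputable def mX : Matrix (Fin d) (Fin d) ℂ :=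
  Matrix.of fun i j => triE (uX q α) (uX q α) (DX q κ x) i j
noncomputable def mY : Matrix (Fin d) (Fin d) ℂ :=
  Matrix.of fun i j => triE (uY q x α) (lY q x α) (DY q κ x) i j


lemma relZX (hq : q ≠ 0) (hq2 : q^2 - 1 ≠ 0) (hq2' : q^2 + 1 ≠ 0) (hx0 : ∀ m, x m ≠ 0)
  (hxs : ∀ m, x (m+1) = q^2 * x m)
  (hx1 : ∀ m, x m ^ 2 + 1 ≠ 0) (hx2 : ∀ m, x m ^ 2 + q^2 ≠ 0) (hx3 : ∀ m, q^2 * x m ^ 2 + 1 ≠ 0)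
  (hx4 : ∀ m, x m ^ 2 + q^4 ≠ 0) (hx5 : ∀ m, q^4 * x m ^ 2 + 1 ≠ 0)
  (hx6 : ∀ m, q^6 * x m ^ 2 + 1 ≠ 0)
  (hα : ∀ m, m ≤ d → α m ^ 2 = ff q κ (x m)) (hα0 : α 0 = 0) (hαd : α d = 0) : mZ q κ d x α * mX q κ d x α = (q⁻¹ ^ 2) • (mX q κ d x α * mZ q κ d x α) := by
  ext i j
  unfold mZ mX
  rw [Matrix.smul_apply, tri_mul' _ _ _ _ _ _ _ (by simp [uZ, hαd]) (by simp [lZ, hα0]), tri_mul' _ _ _ _ _ _ _ (by simp [uX, hαd]) (by simp [uX, hα0]), smul_eq_mul]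
  obtain ⟨i, hi⟩ := i
  obtain ⟨j, hj⟩ := j
  have hA := hα i (by omega)
  have hB := hα (i+1) (by omega)
  rw [hxs] at hB
  have hxs2 : ∀ m, x (m+2) = q^2 * (q^2 * x m) := fun m => by rw [hxs (m+1), hxs]
  simp only [Fin.mk.injEq]
  unfold penE uZ lZ uX DX DZ cc
  simp only [hxs, hxs2]
  have hqq : q - q⁻¹ ≠ 0 := by
    intro h
    apply hq2
    have : q^2 - 1 = q * (q - q⁻¹) := by field_simp
    rw [this, h, mul_zero]
  have hi0 := hx0 i
  have hj0 := hx0 j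
  by_cases c1 : j = i + 2
  · subst c1
    simp
    field_simp
    try ring
  by_cases c2 : j = i + 1
  · subst c2
    simpa using sc_ZX_up q κ (x i) (α (i+1)) hq hq2 hq2' (hx0 i) (hx1 i) (hx2 i) (hx3 i) (hx4 i) (hx5 i) (hx6 i)
  by_cases c3 : j = i
  · subst c3
    simpa using sc_ZX_di q κ (x j) (α j) (α (j+1)) hq hq2 hq2' (hx0 j) (hx1 j) (hx2 j) (hx3 j) (hx4 j) (hx5 j) (hx6 j) hA hB
  by_cases c4 : i = j + 1
  · subst c4
    simpa [c1, c2, c3] using sc_ZX_lo q κ (x j) (α (j+1)) hq hq2 hq2' (hx0 j) (hx1 j) (hx2 j) (hx3 j) (hx4 j) (hx5 j) (hx6 j)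
  by_cases c5 : i = j + 2
  · subst c5
    simp [c1, c2, c3]
    field_simp
    try ring
  · simp [c1, c2, c3, Ne.symm c3, c4, c5]

lemma relZY (hq : q ≠ 0) (hq2 : q^2 - 1 ≠ 0) (hq2' : q^2 + 1 ≠ 0) (hx0 : ∀ m, x m ≠ 0)
  (hxs : ∀ m, x (m+1) = q^2 * x m)
  (hx1 : ∀ m, x m ^ 2 + 1 ≠ 0) (hx2 : ∀ m, x m ^ 2 + q^2 ≠ 0) (hx3 : ∀ m, q^2 * x m ^ 2 + 1 ≠ 0)
  (hx4 : ∀ m, x m ^ 2 + q^4 ≠ 0) (hx5 : ∀ m, q^4 * x m ^ 2 + 1 ≠ 0)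
  (hx6 : ∀ m, q^6 * x m ^ 2 + 1 ≠ 0)
  (hα : ∀ m, m ≤ d → α m ^ 2 = ff q κ (x m)) (hα0 : α 0 = 0) (hαd : α d = 0) : mZ q κ d x α * mY q κ d x α = (q ^ 2) • (mY q κ d x α * mZ q κ d x α) := by
  ext i j
  unfold mZ mY
  rw [Matrix.smul_apply, tri_mul' _ _ _ _ _ _ _ (by simp [uZ, hαd]) (by simp [lZ, hα0]), tri_mul' _ _ _ _ _ _ _ (by simp [uY, hαd]) (by simp [lY, hα0]), smul_eq_mul]
  obtain ⟨i, hi⟩ := i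
  obtain ⟨j, hj⟩ := j
  have hA := hα i (by omega)
  have hB := hα (i+1) (by omega)
  rw [hxs] at hB
  have hxs2 : ∀ m, x (m+2) = q^2 * (q^2 * x m) := fun m => by rw [hxs (m+1), hxs]
  simp only [Fin.mk.injEq]
  unfold penE uZ lZ uY lY DY DX DZ cc
  simp only [hxs, hxs2]
  have hqq : q - q⁻¹ ≠ 0 := by
    intro h
    apply hq2
    have : q^2 - 1 = q * (q - q⁻¹) := by field_simp
    rw [this, h, mul_zero]
  have hi0 := hx0 i
  have hj0 := hx0 j
  by_cases c1 : j = i + 2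
  · subst c1
    simp
    field_simp
    try ring
  by_cases c2 : j = i + 1
  · subst c2
    simpa using sc_ZY_up q κ (x i) (α (i+1)) hq hq2 hq2' (hx0 i) (hx1 i) (hx2 i) (hx3 i) (hx4 i) (hx5 i) (hx6 i)
  by_cases c3 : j = i
  · subst c3
    simpa using sc_ZY_di q κ (x j) (α j) (α (j+1)) hq hq2 hq2' (hx0 j) (hx1 j) (hx2 j) (hx3 j) (hx4 j) (hx5 j) (hx6 j) hA hB
  by_cases c4 : i = j + 1
  · subst c4
    simpa [c1, c2, c3] using sc_ZY_lo q κ (x j) (α (j+1)) hq hq2 hq2' (hx0 j) (hx1 j) (hx2 j) (hx3 j) (hx4 j) (hx5 j) (hx6 j)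
  by_cases c5 : i = j + 2
  · subst c5
    simp [c1, c2, c3]
    field_simp
    try ring
  · simp [c1, c2, c3, Ne.symm c3, c4, c5]

lemma relXY (hq : q ≠ 0) (hq2 : q^2 - 1 ≠ 0) (hq2' : q^2 + 1 ≠ 0) (hx0 : ∀ m, x m ≠ 0)
  (hxs : ∀ m, x (m+1) = q^2 * x m)
  (hx1 : ∀ m, x m ^ 2 + 1 ≠ 0) (hx2 : ∀ m, x m ^ 2 + q^2 ≠ 0) (hx3 : ∀ m, q^2 * x m ^ 2 + 1 ≠ 0)
  (hx4 : ∀ m, x m ^ 2 + q^4 ≠ 0) (hx5 : ∀ m, q^4 * x m ^ 2 + 1 ≠ 0)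
  (hx6 : ∀ m, q^6 * x m ^ 2 + 1 ≠ 0)
  (hα : ∀ m, m ≤ d → α m ^ 2 = ff q κ (x m)) (hα0 : α 0 = 0) (hαd : α d = 0) : q⁻¹ • (mX q κ d x α * mY q κ d x α) - q • (mY q κ d x α * mX q κ d x α) = -((q - q⁻¹)⁻¹ • ((1 : Matrix (Fin d) (Fin d) ℂ) - (mZ q κ d x α) ^ 2)) := by
  ext i j
  unfold mZ mX mY
  rw [pow_two, Matrix.sub_apply, Matrix.neg_apply, Matrix.smul_apply, Matrix.smul_apply, Matrix.smul_apply, Matrix.sub_apply, tri_mul' (uZ q x α) (lZ q x α) _ _ _ _ _ (by simp [uZ, hαd]) (by simp [lZ, hα0]), tri_mul' (uX q α) (uX q α) _ _ _ _ _ (by simp [uX, hαd]) (by simp [uX, hα0]), tri_mul' (uY q x α) (lY q x α) _ _ _ _ _ (by simp [uY, hαd]) (by simp [lY, hα0]), smul_eq_mul, smul_eq_mul, smul_eq_mul, Matrix.one_apply]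
  obtain ⟨i, hi⟩ := i
  obtain ⟨j, hj⟩ := j
  have hA := hα i (by omega)
  have hB := hα (i+1) (by omega)
  rw [hxs] at hB
  have hxs2 : ∀ m, x (m+2) = q^2 * (q^2 * x m) := fun m => by rw [hxs (m+1), hxs]
  simp only [Fin.mk.injEq]
  unfold penE uZ lZ uX uY lY DY DX DZ cc
  simp only [hxs, hxs2]
  have hqq : q - q⁻¹ ≠ 0 := by
    intro h
    apply hq2
    have : q^2 - 1 = q * (q - q⁻¹) := by field_simp
    rw [this, h, mul_zero]
  have hi0 := hx0 i
  have hj0 := hx0 j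
  by_cases c1 : j = i + 2
  · subst c1
    simp
    field_simp
    try ring
  by_cases c2 : j = i + 1
  · subst c2
    simpa using sc_XY_up q κ (x i) (α (i+1)) hq hq2 hq2' (hx0 i) (hx1 i) (hx2 i) (hx3 i) (hx4 i) (hx5 i) (hx6 i)
  by_cases c3 : j = i
  · subst c3
    simpa using sc_XY_di q κ (x j) (α j) (α (j+1)) hq hq2 hq2' (hx0 j) (hx1 j) (hx2 j) (hx3 j) (hx4 j) (hx5 j) (hx6 j) hA hB
  by_cases c4 : i = j + 1
  · subst c4
    simpa [c1, c2, c3] using sc_XY_lo q κ (x j) (α (j+1)) hq hq2 hq2' (hx0 j) (hx1 j) (hx2 j) (hx3 j) (hx4 j) (hx5 j) (hx6 j)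
  by_cases c5 : i = j + 2
  · subst c5
    simp [c1, c2, c3]
    field_simp
    try ring
  · simp [c1, c2, c3, Ne.symm c3, c4, c5]

end core

lemma ff_zero (q u t : ℂ) (hq : q ≠ 0) (ht : t ≠ 0) (h : u^4 = 1 ∨ (u*t)^4 = q^4) :
    ff q (t/q + q/t) (u^2*t) = 0 := by
  unfold ff
  have : (((u^2*t)^2+q^2)^2 - (t/q+q/t)^2 * (q^2 * (u^2*t)^2)) = (u^4-1)*((u*t)^4-q^4) := by
    field_simp
    ring
  rw [this]
  rcases h with h | h <;> simp [h]

lemma ff_val (q u t : ℂ) (hq : q ≠ 0) (ht : t ≠ 0) (hu : u ≠ 0) (h1 : q^2-1 ≠ 0) (h2 : q^2+1 ≠ 0)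
    (hx1 : (u^2*t) ^ 2 + 1 ≠ 0) (hx2 : (u^2*t) ^ 2 + q^2 ≠ 0) (hx4 : (u^2*t) ^ 2 + q^4 ≠ 0) :
    ((u^2-(u^2)⁻¹)/(q^2-(q^2)⁻¹)) * (((u*t/q)^2-((u*t/q)^2)⁻¹)/(q^2-(q^2)⁻¹)) /
      ((u^2*t/q + q/(u^2*t))^2 * ((u^2*t/q^2+q^2/(u^2*t)) * (u^2*t + (u^2*t)⁻¹)))
    = ff q (t/q + q/t) (u^2*t) := by
  unfold ff
  have e1 : q^2-(q^2)⁻¹ = (q^2-1)*(q^2+1)/q^2 := by field_simp; ring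
  have e2 : u^2*t/q + q/(u^2*t) = ((u^2*t)^2+q^2)/(q*(u^2*t)) := by field_simp
  have e3 : u^2*t/q^2 + q^2/(u^2*t) = ((u^2*t)^2+q^4)/(q^2*(u^2*t)) := by field_simp
  have e4 : u^2*t + (u^2*t)⁻¹ = ((u^2*t)^2+1)/(u^2*t) := by field_simp
  have e5 : q^4-1 = (q^2-1)*(q^2+1) := by ring
  have e6 : (((u^2*t)^2+q^2)^2 - (t/q+q/t)^2 * (q^2 * (u^2*t)^2)) = (u^4-1)*((u*t)^4-q^4) := by
    field_simp
    ring
  rw [e1, e2, e3, e4, e5, e6]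
  generalize hw1 : (u^2*t)^2+1 = w1 at *
  generalize hw2 : (u^2*t)^2+q^2 = w2 at *
  generalize hw4 : (u^2*t)^2+q^4 = w4 at *
  field_simp

/-- For `q = exp(iπP/Q)`, `n ∈ {1,...,Q}`, `d = Q+1−n`, and any complex numbers
`a_1,...,a_{d−1}` with
`a_m² = [m]_{q²}[m+n−1]_{q²}/((q^{2m+n−1}+q^{−2m−n+1})²(q^{2m+n−2}+q^{−2m−n+2})(q^{2m+n}+q^{−2m−n}))`
(and `b_m = a_m`), the tridiagonal matrices `ρ(X), ρ(Y), ρ(Z)` satisfy the defining relations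
`ρ(Z)ρ(X) = q⁻²ρ(X)ρ(Z)`, `ρ(Z)ρ(Y) = q²ρ(Y)ρ(Z)`,
`q⁻¹ρ(X)ρ(Y) − qρ(Y)ρ(X) = −(1 − ρ(Z)²)/(q − q⁻¹)`. -/
theorem stmt_16 (Q P : ℕ) (hQodd : Odd Q) (hQpos : 0 < Q)
    (hP1 : 1 ≤ P) (hPQ : P ≤ Q - 1) (hcop : Nat.Coprime P Q)
    (q : ℂ) (hq : q = Complex.exp (↑Real.pi * Complex.I * (P : ℂ) / (Q : ℂ)))
    (n : ℕ) (hn1 : 1 ≤ n) (hnQ : n ≤ Q) (d : ℕ) (hd : d = Q + 1 - n)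
    (a : ℕ → ℂ)
    (ha : ∀ m : ℕ, 1 ≤ m → m ≤ d - 1 →
      a m ^ 2 = qnum (q ^ 2) (m : ℤ) * qnum (q ^ 2) ((m : ℤ) + (n : ℤ) - 1) /
        ((q ^ (2 * (m : ℤ) + n - 1) + q ^ (-(2 * (m : ℤ)) - n + 1)) ^ 2 *
          ((q ^ (2 * (m : ℤ) + n - 2) + q ^ (-(2 * (m : ℤ)) - n + 2)) *
            (q ^ (2 * (m : ℤ) + n) + q ^ (-(2 * (m : ℤ)) - n))))) :
    let c : ℕ → ℂ := fun m =>
      (q ^ ((n : ℤ) - 1) + q ^ (-(n : ℤ) + 1)) /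
        ((q ^ (2 * (m : ℤ) + n - 1) + q ^ (-(2 * (m : ℤ)) - n + 1)) *
          (q ^ (2 * (m : ℤ) + n + 1) + q ^ (-(2 * (m : ℤ)) - n - 1)))
    let dd : ℕ → ℂ := fun m =>
      (q ^ ((n : ℤ) - 1) + q ^ (-(n : ℤ) + 1)) * qnum q (2 * (m : ℤ) + n) /
        ((q ^ (2 * (m : ℤ) + n - 1) + q ^ (-(2 * (m : ℤ)) - n + 1)) *
          (q ^ (2 * (m : ℤ) + n + 1) + q ^ (-(2 * (m : ℤ)) - n - 1)))
    let ρZ : Matrix (Fin d) (Fin d) ℂ := Matrix.of fun i j =>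
      if (j : ℕ) = (i : ℕ) + 1 then
        -(q ^ (2 : ℤ) - q ^ (-2 : ℤ)) * q ^ (2 * (j : ℤ) + n - 1) * a (j : ℕ)
      else if (i : ℕ) = (j : ℕ) + 1 then
        (q ^ (2 : ℤ) - q ^ (-2 : ℤ)) * q ^ (-(2 * (j : ℤ)) - n - 1) * a ((j : ℕ) + 1)
      else if i = j then (q + q⁻¹) * c (i : ℕ) else 0
    let ρX : Matrix (Fin d) (Fin d) ℂ := Matrix.of fun i j =>
      if (j : ℕ) = (i : ℕ) + 1 then (q + q⁻¹) * a (j : ℕ)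
      else if (i : ℕ) = (j : ℕ) + 1 then (q + q⁻¹) * a ((j : ℕ) + 1)
      else if i = j then dd (i : ℕ) else 0
    let ρY : Matrix (Fin d) (Fin d) ℂ := Matrix.of fun i j =>
      if (j : ℕ) = (i : ℕ) + 1 then (q + q⁻¹) * q ^ (2 * (2 * (j : ℤ) + n - 1)) * a (j : ℕ)
      else if (i : ℕ) = (j : ℕ) + 1 then
        (q + q⁻¹) * q ^ (-(2 * (2 * (j : ℤ) + n + 1))) * a ((j : ℕ) + 1)
      else if i = j then -dd (i : ℕ) else 0
    ρZ * ρX = (q⁻¹ ^ 2) • (ρX * ρZ) ∧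
    ρZ * ρY = (q ^ 2) • (ρY * ρZ) ∧
    q⁻¹ • (ρX * ρY) - q • (ρY * ρX)
      = -((q - q⁻¹)⁻¹ • ((1 : Matrix (Fin d) (Fin d) ℂ) - ρZ ^ 2)) := by
  have hq0 : q ≠ 0 := by rw [hq]; exact Complex.exp_ne_zero _
  have hQ0 : (Q : ℂ) ≠ 0 := by exact_mod_cast hQpos.ne'
  have hq2Q : q ^ (2 * Q) = 1 := by
    rw [hq, ← Complex.exp_nat_mul, Complex.exp_eq_one_iff]
    refine ⟨P, ?_⟩
    push_cast
    field_simp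
  have hk : ∀ k : ℤ, (q ^ k) ^ 2 + 1 ≠ 0 := by
    intro k h
    have h1 : (q ^ k) ^ 2 = -1 := by linear_combination h
    have h2 : ((q ^ k) ^ 2) ^ Q = 1 := by
      rw [← pow_mul, ← zpow_natCast, zpow_comm, zpow_natCast, hq2Q, one_zpow]
    rw [h1, hQodd.neg_one_pow] at h2
    norm_num at h2
  have hq2' : q ^ 2 + 1 ≠ 0 := by simpa using hk 1
  have hq2 : q ^ 2 - 1 ≠ 0 := by
    intro h
    have h1 : q ^ 2 = 1 := by linear_combination h
    rw [hq, ← Complex.exp_nat_mul, Complex.exp_eq_one_iff] at h1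
    obtain ⟨N, hN⟩ := h1
    have hpi : (Real.pi : ℂ) ≠ 0 := by exact_mod_cast Real.pi_ne_zero
    have hI := Complex.I_ne_zero
    push_cast at hN
    field_simp at hN
    have h3 : (P : ℤ) = Q * N := by exact_mod_cast hN
    have h4 : (Q : ℤ) ∣ P := ⟨N, h3⟩
    have h5 : Q ∣ P := by exact_mod_cast h4
    have h6 := Nat.le_of_dvd (by omega) h5
    omega
  set x : ℕ → ℂ := fun m => q ^ (2 * (m : ℤ) + n) with hxdef
  have hx0 : ∀ m, x m ≠ 0 := fun m => zpow_ne_zero _ hq0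
  have hxs : ∀ m, x (m+1) = q^2 * x m := by
    intro m
    simp only [hxdef]
    rw [← zpow_natCast q 2, ← zpow_add₀ hq0]
    congr 1
    push_cast
    ring
  have hx1 : ∀ m, x m ^ 2 + 1 ≠ 0 := fun m => hk _
  have hgen : ∀ (m : ℕ) (k : ℤ), (x m * q ^ k) ^ 2 + 1 ≠ 0 := by
    intro m k
    simp only [hxdef]
    rw [← zpow_add₀ hq0]
    exact hk _
  have hx2 : ∀ m, x m ^ 2 + q ^ 2 ≠ 0 := by
    intro m h
    apply hgen m (-1)
    have : (x m * q ^ (-1 : ℤ)) ^ 2 + 1 = (x m ^ 2 + q ^ 2) / q ^ 2 := by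
      rw [zpow_neg_one]; field_simp
    rw [this, h, zero_div]
  have hx4 : ∀ m, x m ^ 2 + q ^ 4 ≠ 0 := by
    intro m h
    apply hgen m (-2)
    have : (x m * q ^ (-2 : ℤ)) ^ 2 + 1 = (x m ^ 2 + q ^ 4) / q ^ 4 := by
      rw [zpow_neg]; field_simp
    rw [this, h, zero_div]
  have hx3 : ∀ m, q ^ 2 * x m ^ 2 + 1 ≠ 0 := by
    intro m h
    apply hgen m 1
    rw [zpow_one, ← h]; ring
  have hx5 : ∀ m, q ^ 4 * x m ^ 2 + 1 ≠ 0 := by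
    intro m h
    apply hgen m 2
    rw [← h, zpow_ofNat]; ring
  have hx6 : ∀ m, q ^ 6 * x m ^ 2 + 1 ≠ 0 := by
    intro m h
    apply hgen m 3
    rw [← h, zpow_ofNat]; ring
  -- rewriting of the powers
  have p0 : ∀ m : ℕ, q ^ (2 * (m : ℤ) + n) = x m := fun m => rfl
  have p0' : ∀ m : ℕ, q ^ (-(2 * (m : ℤ)) - n) = (x m)⁻¹ := by
    intro m; rw [← p0, ← zpow_neg]; congr 1; ring
  have p1 : ∀ m : ℕ, q ^ (2 * (m : ℤ) + n - 1) = x m / q := by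
    intro m; rw [← p0, zpow_sub_one₀ hq0]; rfl
  have p1' : ∀ m : ℕ, q ^ (-(2 * (m : ℤ)) - n + 1) = q / x m := by
    intro m; rw [zpow_add_one₀ hq0, p0']; ring
  have p2 : ∀ m : ℕ, q ^ (2 * (m : ℤ) + n + 1) = x m * q := by
    intro m; rw [← p0, zpow_add_one₀ hq0]
  have p2' : ∀ m : ℕ, q ^ (-(2 * (m : ℤ)) - n - 1) = (x m)⁻¹ / q := by
    intro m; rw [zpow_sub_one₀ hq0, p0']; rfl
  have p3 : ∀ m : ℕ, q ^ (2 * (m : ℤ) + n - 2) = x m / q ^ 2 := by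
    intro m; rw [← p0, zpow_sub₀ hq0]; rfl
  have p3' : ∀ m : ℕ, q ^ (-(2 * (m : ℤ)) - n + 2) = q ^ 2 / x m := by
    intro m; rw [zpow_add₀ hq0, p0', zpow_ofNat]; ring
  have p4 : ∀ m : ℕ, q ^ (2 * (2 * (m : ℤ) + n - 1)) = (x m / q) ^ 2 := by
    intro m; rw [← p1, mul_comm, zpow_mul]; rfl
  have p4' : ∀ m : ℕ, q ^ (-(2 * (2 * (m : ℤ) + n + 1))) = ((x m * q) ^ 2)⁻¹ := by
    intro m; rw [zpow_neg, ← p2, mul_comm, zpow_mul]; rfl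
  set t : ℂ := q ^ n with htdef
  have ht : t ≠ 0 := pow_ne_zero _ hq0
  have k1 : q ^ ((n : ℤ) - 1) = t / q := by rw [zpow_sub_one₀ hq0, zpow_natCast]; rfl
  have k1' : q ^ (-(n : ℤ) + 1) = q / t := by
    rw [zpow_add_one₀ hq0, zpow_neg, zpow_natCast, ← htdef]; ring
  have xu : ∀ m, x m = (q ^ m) ^ 2 * t := by
    intro m
    rw [← p0, zpow_add₀ hq0, zpow_mul, zpow_natCast, zpow_natCast, ← htdef, zpow_ofNat,
      ← pow_mul, ← pow_mul, mul_comm 2 m]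
  have m2 : q ^ (-2 : ℤ) = (q ^ 2)⁻¹ := by rw [zpow_neg]; rfl
  have m2' : q ^ (2 : ℤ) = q ^ 2 := rfl
  set α : ℕ → ℂ := fun m => if 1 ≤ m ∧ m ≤ d - 1 then a m else 0 with hαdef
  have hα0 : α 0 = 0 := by simp [hαdef]
  have hαd : α d = 0 := by
    simp only [hαdef]
    rw [if_neg]
    omega
  have hαa : ∀ m, 1 ≤ m → m < d → α m = a m := by
    intro m h1 h2
    simp only [hαdef]
    rw [if_pos]
    omega
  have hα : ∀ m, m ≤ d → α m ^ 2 = ff q (t / q + q / t) (x m) := by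
    intro m hm
    rcases Nat.eq_zero_or_pos m with h0 | h0
    · subst h0
      rw [hα0, xu, ff_zero q _ t hq0 ht (by left; simp)]; simp
    rcases hm.eq_or_lt with h1 | h1
    · rw [h1, hαd, xu, ff_zero q _ t hq0 ht ?_]
      · simp
      · right
        have e : q ^ d * t = q ^ (Q + 1) := by
          rw [htdef, ← pow_add]; congr 1; omega
        have e2 : (q ^ (Q + 1)) ^ 4 = (q ^ (2 * Q)) ^ 2 * q ^ 4 := by ring
        rw [e, e2, hq2Q]; ring
    · rw [hαa m h0 h1, ha m h0 (by omega)]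
      have hum : q ^ m ≠ 0 := pow_ne_zero _ hq0
      have y1 := hx1 m
      have y2 := hx2 m
      have y4 := hx4 m
      rw [xu] at y1 y2 y4
      rw [p0, p0', p1, p1', p3, p3', xu, ← ff_val q (q ^ m) t hq0 ht hum hq2 hq2' y1 y2 y4]
      have z1 : (q ^ 2) ^ (m : ℤ) = (q ^ m) ^ 2 := by
        rw [zpow_natCast, ← pow_mul, ← pow_mul, mul_comm]
      have z2 : (q ^ 2) ^ ((m : ℤ) + (n : ℤ) - 1) = (q ^ m * t / q) ^ 2 := by
        have z3 : (q ^ 2) ^ n = t ^ 2 := by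
          rw [htdef, ← pow_mul, ← pow_mul, mul_comm]
        rw [zpow_sub_one₀ (pow_ne_zero _ hq0), zpow_add₀ (pow_ne_zero _ hq0), z1, zpow_natCast, z3]
        field_simp
      unfold qnum
      rw [zpow_neg, zpow_neg, z1, z2]
  intro c dd ρZ ρX ρY
  have hc : ∀ m, c m = cc q (t / q + q / t) x m := by
    intro m
    have y0 := hx0 m
    have y2 := hx2 m
    have y3 := hx3 m
    simp only [c, cc]
    rw [k1, k1', p1, p1', p2, p2']
    have e1 : x m / q + q / x m = (x m ^ 2 + q ^ 2) / (q * x m) := by field_simp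
    have e2 : x m * q + (x m)⁻¹ / q = (q ^ 2 * x m ^ 2 + 1) / (q * x m) := by
      field_simp
    rw [e1, e2]
    generalize t / q + q / t = κ
    generalize x m ^ 2 + q ^ 2 = w at *
    generalize q ^ 2 * x m ^ 2 + 1 = w' at *
    field_simp
  have hdd : ∀ m, dd m = DX q (t / q + q / t) x m := by
    intro m
    have : dd m = c m * qnum q (2 * (m : ℤ) + n) := by
      simp only [dd, c]; ring
    rw [this, hc]
    unfold DX qnum
    rw [zpow_neg, p0]
    ring
  have hZ : ρZ = mZ q (t / q + q / t) d x α := by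
    ext i j
    simp only [ρZ, mZ, triE, Matrix.of_apply, Fin.ext_iff]
    split_ifs with h1 h2 h3
    · simp only [uZ]
      rw [hαa j (by omega) j.2, p1, m2, m2']
    · simp only [lZ]
      rw [hαa i (by omega) i.2, p2', m2, m2', h2, hxs]
      have y0 := hx0 j
      field_simp
    · simp only [DZ]
      rw [hc]
    · rfl
  have hX : ρX = mX q (t / q + q / t) d x α := by
    ext i j
    simp only [ρX, mX, triE, Matrix.of_apply, Fin.ext_iff]
    split_ifs with h1 h2 h3
    · simp only [uX]
      rw [hαa j (by omega) j.2]
    · simp only [uX]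
      rw [hαa i (by omega) i.2, h2]
    · rw [hdd]
    · rfl
  have hY : ρY = mY q (t / q + q / t) d x α := by
    ext i j
    simp only [ρY, mY, triE, Matrix.of_apply, Fin.ext_iff]
    split_ifs with h1 h2 h3
    · simp only [uY]
      rw [hαa j (by omega) j.2, p4]
    · simp only [lY]
      rw [hαa i (by omega) i.2, p4', h2, hxs]
      have y0 := hx0 j
      field_simp
    · simp only [DY]
      rw [hdd]
    · rfl
  rw [hZ, hX, hY]
  exact ⟨relZX q _ d x α hq0 hq2 hq2' hx0 hxs hx1 hx2 hx3 hx4 hx5 hx6 hα hα0 hαd,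
    relZY q _ d x α hq0 hq2 hq2' hx0 hxs hx1 hx2 hx3 hx4 hx5 hx6 hα hα0 hαd,
    relXY q _ d x α hq0 hq2 hq2' hx0 hxs hx1 hx2 hx3 hx4 hx5 hx6 hα hα0 hαd⟩
end
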